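/- arXiv:2305.02431 — 2 statements merged into one kernel-verified Lean document; each statement's English description precedes it below -/
import Mathlib

section
/- Let n = 4 and let ω = dq¹∧dq³∧dq⁴∧dp₂ − dq²∧dq³∧dq⁴∧dp₁ + (1/3)(dq¹∧dq²∧dp₁∧dp₂ + dq³∧dq⁴∧dp₃∧dp₄) − (1/6)(dq¹∧dq³∧dp₁∧dp₃ + dq¹∧dq⁴∧dp₁∧dp₄ + dq²∧dq³∧dp₂∧dp₃ + dq²∧dq⁴∧dp₂∧dp₄) on ℝ⁹. Then: (i) ω is effective and (j¹φ)*ω = (φ₁₃φ₂₄ − φ₁₄φ₂₃ + φ₁₁ + φ₂₂)·β for every smooth φ: ℝ⁴ → ℝ, where φ_{μν} := ∂²φ/∂q^μ∂q^ν, so ω represents the Husain equation φ₁₃φ₂₄ − φ₁₄φ₂₃ + φ₁₁ + φ₂₂ = 0; and (ii) there exist no smooth function L: ℝ⁹ → ℝ and no nowhere-vanishing smooth function k: ℝ⁹ → ℝ such that k·ω = E(Lβ). Hence the Husain equation is not the Euler–Lagrange equation of any first-order Lagrangian. -/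
noncomputable section

namespace MA

/-- Points / tangent vectors of ℝ^m. -/
abbrev Vec (m : ℕ) := Fin m → ℝ

/-- An (unbundled) differential `k`-form on ℝ^m : at each point it eats a
`k`-tuple of tangent vectors and returns a real number. -/
abbrev Form (m k : ℕ) := Vec m → (Fin k → Vec m) → ℝ

/-- `ω` is pointwise an alternating multilinear map, i.e. a genuine exterior form. -/
def IsForm {m k : ℕ} (ω : Form m k) : Prop :=
  ∀ x : Vec m, ∃ a : AlternatingMap ℝ (Vec m) ℝ (Fin k), ∀ v, ω x v = a v

/-- Smoothness of a differential form (smoothness of all coefficients). -/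
def SmoothForm {m k : ℕ} (ω : Form m k) : Prop :=
  ∀ v : Fin k → Vec m, ContDiff ℝ (⊤ : ℕ∞) fun x => ω x v

/-- Multiplication of a form by a scalar function. -/
def fsmul {m k : ℕ} (f : Vec m → ℝ) (ω : Form m k) : Form m k := fun x v => f x * ω x v

/-- Wedge (exterior) product of differential forms. -/
def wedge {m k l : ℕ} (ω : Form m k) (η : Form m l) : Form m (k + l) := fun x v =>
  ((k.factorial * l.factorial : ℕ) : ℝ)⁻¹ *
    ∑ σ : Equiv.Perm (Fin (k + l)),
      ((Equiv.Perm.sign σ : ℤ) : ℝ) *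
        (ω x fun i => v (σ (Fin.castAdd l i))) *
        (η x fun j => v (σ (Fin.natAdd k j)))

/-- Interior product (contraction) of a form with a (constant) vector. -/
def iprod {m : ℕ} (u : Vec m) : ∀ {k : ℕ}, Form m k → Form m (k - 1)
  | 0, _ => 0
  | _ + 1, ω => fun x v => ω x (Fin.cons u v)

/-- Exterior derivative of a differential form (coordinate formula). -/
def exd {m k : ℕ} (ω : Form m k) : Form m (k + 1) := fun x v =>
  ∑ i : Fin (k + 1),
    (-1 : ℝ) ^ (i : ℕ) * fderiv ℝ (fun y => ω y fun j => v (i.succAbove j)) x (v i)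

/-- Change the (propositionally equal) degree of a form. -/
def reindex {m k l : ℕ} (h : k = l) (ω : Form m k) : Form m l :=
  fun x v => ω x fun i => v (Fin.cast h i)

/-- Pullback of a differential form along a map. -/
def pullback {a b k : ℕ} (f : Vec a → Vec b) (ω : Form b k) : Form a k :=
  fun x v => ω (f x) fun i => fderiv ℝ f x (v i)

/-- `i`-th standard basis vector of ℝ^m. -/
def basisVec {m : ℕ} (i : Fin m) : Vec m := Pi.single i 1

/-- The coordinate 1-form `dx^i`. -/
def dx {m : ℕ} (i : Fin m) : Form m 1 := fun _ v => v 0 i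

/-- Partial derivative of a function in the `i`-th coordinate direction. -/
def pd {m : ℕ} (i : Fin m) (f : Vec m → ℝ) : Vec m → ℝ := fun x => fderiv ℝ f x (basisVec i)

/- Jet-space coordinates on J¹ℝⁿ = ℝ^{2n+1} : (q¹,…,qⁿ,u,p₁,…,pₙ). -/

/-- Index of the coordinate `q^μ`. -/
def qIdx {n : ℕ} (μ : Fin n) : Fin (2 * n + 1) := ⟨μ, by have := μ.isLt; omega⟩

/-- Index of the coordinate `u`. -/
def uIdx {n : ℕ} : Fin (2 * n + 1) := ⟨n, by omega⟩

/-- Index of the coordinate `p_μ`. -/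
def pIdx {n : ℕ} (μ : Fin n) : Fin (2 * n + 1) := ⟨n + 1 + μ, by have := μ.isLt; omega⟩

/-- The Reeb field `χ = ∂/∂u` (a constant vector field). -/
def chi {n : ℕ} : Vec (2 * n + 1) := basisVec uIdx

/-- The standard contact form `c = du - Σ p_μ dq^μ` on J¹ℝⁿ. -/
def contact {n : ℕ} : Form (2 * n + 1) 1 := fun x v =>
  v 0 uIdx - ∑ μ : Fin n, x (pIdx μ) * v 0 (qIdx μ)

/-- The symplectic-type 2-form `Ω = dc = Σ dq^μ ∧ dp_μ`. -/
def symp {n : ℕ} : Form (2 * n + 1) 2 := ∑ μ : Fin n, wedge (dx (qIdx μ)) (dx (pIdx μ))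

/-- The bottom operator `⊥ = Σ_μ ∂_{p_μ} ⌟ ∂_{q^μ} ⌟ ·` (zero on forms of degree ≤ 1). -/
def botOp {n k : ℕ} (ω : Form (2 * n + 1) k) : Form (2 * n + 1) (k - 2) :=
  ∑ μ : Fin n, iprod (basisVec (pIdx μ)) (iprod (basisVec (qIdx μ)) ω)

/-- A form is effective if it is killed by `χ ⌟ ·` and by `⊥`. -/
def Effective {n k : ℕ} (ω : Form (2 * n + 1) k) : Prop :=
  iprod (chi (n := n)) ω = 0 ∧ botOp ω = 0

/-- The projection `p(α) = α - c ∧ (χ ⌟ α)` onto forms annihilated by `χ ⌟ ·`. -/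
def proj {n : ℕ} : ∀ {k : ℕ}, Form (2 * n + 1) k → Form (2 * n + 1) k
  | 0, α => α
  | j + 1, α => α - reindex (Nat.add_comm 1 j) (wedge contact (iprod (chi (n := n)) α))

/-- The projected exterior derivative `d_p = p ∘ d`. -/
def dproj {n k : ℕ} (ω : Form (2 * n + 1) k) : Form (2 * n + 1) (k + 1) := proj (exd ω)

/-- Lie derivative along the (constant) Reeb field `χ`. -/
def lieChi {n k : ℕ} (ω : Form (2 * n + 1) k) : Form (2 * n + 1) k := fun x v =>
  fderiv ℝ (fun y => ω y v) x (chi (n := n))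

/-- The Euler operator `E = d_p ∘ ⊥ ∘ d_p + L_χ` on n-forms over J¹ℝⁿ. -/
def euler : ∀ {n : ℕ}, Form (2 * n + 1) n → Form (2 * n + 1) n
  | 0, ω => lieChi ω
  | n + 1, ω =>
    reindex (show n + 1 + 1 - 2 + 1 = n + 1 by omega) (dproj (botOp (dproj ω))) + lieChi ω

/-- The horizontal volume form `β = dq¹ ∧ … ∧ dqⁿ` on J¹ℝⁿ. -/
def qvol {n : ℕ} : Form (2 * n + 1) n := fun _ v =>
  Matrix.det (Matrix.of fun i j : Fin n => v i (qIdx j))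

/-- The volume form `β = dq¹ ∧ … ∧ dqⁿ` on the base ℝⁿ. -/
def baseVol {n : ℕ} : Form n n := fun _ v => Matrix.det (Matrix.of fun i j : Fin n => v i j)

/-- `β_μ = ∂_{q^μ} ⌟ β`. -/
def betaMu {n : ℕ} (μ : Fin n) : Form (2 * n + 1) (n - 1) := iprod (basisVec (qIdx μ)) qvol

/-- The first jet prolongation `j¹φ : ℝⁿ → ℝ^{2n+1}`, `x ↦ (x, φ(x), ∂₁φ(x), …, ∂ₙφ(x))`. -/
def jet {n : ℕ} (φ : Vec n → ℝ) (x : Vec n) : Vec (2 * n + 1) := fun i =>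
  if h : (i : ℕ) < n then x ⟨i, h⟩
  else if h2 : (i : ℕ) = n then φ x
  else fderiv ℝ φ x (basisVec ⟨(i : ℕ) - (n + 1), by have := i.isLt; omega⟩)

/-- Second partial derivative `φ_{μν} = ∂²φ/∂q^μ∂q^ν`. -/
def d2 {n : ℕ} (φ : Vec n → ℝ) (μ ν : Fin n) : Vec n → ℝ := fun x =>
  fderiv ℝ (fun y => fderiv ℝ φ y (basisVec ν)) x (basisVec μ)

/-- A form is multisymplectic if it is closed and pointwise nondegenerate. -/
def Multisymplectic {m k : ℕ} (μ : Form m k) : Prop :=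
  exd μ = 0 ∧ ∀ (x v : Vec m), iprod v μ x = 0 → v = 0

/-- Lift a form on J¹ℝⁿ = ℝ^{2n+1} to ℝ^{2n+2} = J¹ℝⁿ × ℝ (extra coordinate `e`)
along the projection. -/
def liftForm {n k : ℕ} (ω : Form (2 * n + 1) k) : Form (2 * n + 1 + 1) k :=
  pullback (fun y (i : Fin (2 * n + 1)) => y i.castSucc) ω

/-- The 1-form `de` on ℝ^{2n+2}. -/
def deForm {n : ℕ} : Form (2 * n + 1 + 1) 1 := dx (Fin.last (2 * n + 1))

/-- The (n+1)-form `m_ω = de ∧ β + c ∧ ω` on ℝ^{2n+2}. -/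
def msf {n : ℕ} (ω : Form (2 * n + 1) n) : Form (2 * n + 1 + 1) (n + 1) :=
  reindex (Nat.add_comm 1 n) (wedge (deForm (n := n)) (liftForm qvol)) +
    reindex (Nat.add_comm 1 n) (wedge (liftForm (contact (n := n))) (liftForm ω))

/-- Wedge of four coordinate 1-forms on ℝ⁹ = J¹ℝ⁴. -/
def dd (i j k l : Fin (2 * 4 + 1)) : Form (2 * 4 + 1) 4 :=
  wedge (wedge (wedge (dx i) (dx j)) (dx k)) (dx l)

/-- The effective 4-form on ℝ⁹ representing the Husain equation. -/
def omegaH : Form (2 * 4 + 1) 4 :=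
  dd (qIdx 0) (qIdx 2) (qIdx 3) (pIdx 1) - dd (qIdx 1) (qIdx 2) (qIdx 3) (pIdx 0) +
    (1 / 3 : ℝ) • (dd (qIdx 0) (qIdx 1) (pIdx 0) (pIdx 1) +
      dd (qIdx 2) (qIdx 3) (pIdx 2) (pIdx 3)) -
    (1 / 6 : ℝ) • (dd (qIdx 0) (qIdx 2) (pIdx 0) (pIdx 2) +
      dd (qIdx 0) (qIdx 3) (pIdx 0) (pIdx 3) +
      dd (qIdx 1) (qIdx 2) (pIdx 1) (pIdx 2) +
      dd (qIdx 1) (qIdx 3) (pIdx 1) (pIdx 3))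

/-- The constant `k`-form `dx^{c 0} ∧ … ∧ dx^{c (k-1)}`, written as a determinant. -/
def coordForm {m k : ℕ} (c : Fin k → Fin m) : Form m k := fun _ v =>
  Matrix.det (Matrix.of fun i j : Fin k => v i (c j))

theorem dx_eq_coordForm {m : ℕ} (i : Fin m) : dx i = coordForm ![i] := by
  funext x v
  simp [dx, coordForm]

theorem wedge_coordForm_dx {m k : ℕ} (c : Fin k → Fin m) (l : Fin m) :
    wedge (coordForm c) (dx l) = coordForm (Fin.snoc (α := fun _ => Fin m) c l) := by
  funext x v
  have key (τ : Equiv.Perm (Fin k)) :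
      ∑ σ : Equiv.Perm (Fin (k + 1)), ((Equiv.Perm.sign σ : ℤ) : ℝ) *
        (((Equiv.Perm.sign τ : ℤ) : ℝ) * ∏ b, v (σ (Fin.castAdd 1 (τ b))) (c b)) *
          v (σ (Fin.natAdd k 0)) l =
        coordForm (Fin.snoc (α := fun _ => Fin m) c l) x v := by
    rw [coordForm, Matrix.det_apply']
    refine Fintype.sum_equiv
      (Equiv.mulRight (finSumFinEquiv.permCongr (Equiv.Perm.sumCongr τ 1))) _ _ fun σ => ?_
    have h1 (b : Fin k) : finSumFinEquiv.symm b.castSucc = (Sum.inl b : Fin k ⊕ Fin 1) :=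
      finSumFinEquiv_symm_apply_castAdd b
    have h2 : finSumFinEquiv.symm (Fin.last k) = (Sum.inr 0 : Fin k ⊕ Fin 1) :=
      finSumFinEquiv_symm_apply_natAdd (0 : Fin 1)
    simp [Fin.prod_univ_castSucc, h1, h2, Equiv.permCongr_apply, mul_assoc]
  have hk : ((k.factorial : ℕ) : ℝ) ≠ 0 := by exact_mod_cast k.factorial_ne_zero
  calc wedge (coordForm c) (dx l) x v
      = ((k.factorial : ℕ) : ℝ)⁻¹ * ∑ τ : Equiv.Perm (Fin k),
          ∑ σ : Equiv.Perm (Fin (k + 1)), ((Equiv.Perm.sign σ : ℤ) : ℝ) *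
          (((Equiv.Perm.sign τ : ℤ) : ℝ) * ∏ b, v (σ (Fin.castAdd 1 (τ b))) (c b)) *
          v (σ (Fin.natAdd k 0)) l := by
        rw [Finset.sum_comm]
        simp [wedge, coordForm, dx, Matrix.det_apply', Finset.mul_sum, Finset.sum_mul]
    _ = coordForm (Fin.snoc (α := fun _ => Fin m) c l) x v := by
        simp [key, Fintype.card_perm, hk]

theorem dd_eq_coordForm (i j k l : Fin (2 * 4 + 1)) :
    dd i j k l = coordForm ![i, j, k, l] := by
  rw [dd, dx_eq_coordForm i, wedge_coordForm_dx, wedge_coordForm_dx, wedge_coordForm_dx]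
  congr 1
  funext a
  fin_cases a <;> rfl

theorem coordForm_four {m : ℕ} (i j k l : Fin m) (x : Vec m) (v : Fin 4 → Vec m) :
    coordForm ![i, j, k, l] x v =
      (v 0 i * v 1 j - v 0 j * v 1 i) * (v 2 k * v 3 l - v 2 l * v 3 k) -
      (v 0 i * v 1 k - v 0 k * v 1 i) * (v 2 j * v 3 l - v 2 l * v 3 j) +
      (v 0 i * v 1 l - v 0 l * v 1 i) * (v 2 j * v 3 k - v 2 k * v 3 j) +
      (v 0 j * v 1 k - v 0 k * v 1 j) * (v 2 i * v 3 l - v 2 l * v 3 i) -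
      (v 0 j * v 1 l - v 0 l * v 1 j) * (v 2 i * v 3 k - v 2 k * v 3 i) +
      (v 0 k * v 1 l - v 0 l * v 1 k) * (v 2 i * v 3 j - v 2 j * v 3 i) := by
  rw [coordForm, Matrix.det_succ_row_zero]
  have h11 : (1 : Fin 4).succAbove (1 : Fin 3) = 2 := rfl
  have h12 : (1 : Fin 4).succAbove (2 : Fin 3) = 3 := rfl
  have h21 : (2 : Fin 4).succAbove (1 : Fin 3) = 1 := rfl
  have h22 : (2 : Fin 4).succAbove (2 : Fin 3) = 3 := rfl
  have h31 : (3 : Fin 4).succAbove (1 : Fin 3) = 1 := rfl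
  have h32 : (3 : Fin 4).succAbove (2 : Fin 3) = 2 := rfl
  simp [Fin.sum_univ_four, Matrix.det_fin_three, h11, h12, h21, h22, h31, h32]
  ring

theorem iprod_chi_omegaH : iprod (chi (n := 4)) omegaH = 0 := by
  funext x v
  simp [iprod, omegaH, dd_eq_coordForm, coordForm_four, chi, basisVec, qIdx, pIdx, uIdx]

theorem botOp_omegaH : botOp (n := 4) omegaH = 0 := by
  funext x v
  have h2 (a b : Vec (2 * 4 + 1)) (w : Fin 2 → Vec (2 * 4 + 1)) :
      (Fin.cons a (Fin.cons b w : Fin 3 → _) : Fin 4 → Vec (2 * 4 + 1)) 2 = w 0 := rfl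
  have h3 (a b : Vec (2 * 4 + 1)) (w : Fin 2 → Vec (2 * 4 + 1)) :
      (Fin.cons a (Fin.cons b w : Fin 3 → _) : Fin 4 → Vec (2 * 4 + 1)) 3 = w 1 := rfl
  have h1 (a b : Vec (2 * 4 + 1)) (w : Fin 2 → Vec (2 * 4 + 1)) :
      (Fin.cons a (Fin.cons b w : Fin 3 → _) : Fin 4 → Vec (2 * 4 + 1)) 1 = b := rfl
  have h0 (a b : Vec (2 * 4 + 1)) (w : Fin 2 → Vec (2 * 4 + 1)) :
      (Fin.cons a (Fin.cons b w : Fin 3 → _) : Fin 4 → Vec (2 * 4 + 1)) 0 = a := rfl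
  have e (ω : Form (2 * 4 + 1) 4) : botOp (n := 4) ω x v =
    ∑ μ : Fin 4, ω x (Fin.cons (basisVec (qIdx μ)) (Fin.cons (basisVec (pIdx μ)) v : Fin 3 → _)) := by
    simp [botOp, iprod]
  rw [e]
  simp only [omegaH, dd_eq_coordForm, Pi.add_apply, Pi.sub_apply, Pi.smul_apply, coordForm_four,
    h0, h1, h2, h3]
  simp [basisVec, Fin.sum_univ_succ, qIdx, pIdx, Pi.single_apply]
  ring

theorem differentiable_fderiv {φ : Vec 4 → ℝ} (hφ : ContDiff ℝ (⊤ : ℕ∞) φ) :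
    Differentiable ℝ (fderiv ℝ φ) :=
  ((contDiff_infty.1 hφ 2).fderiv_right (m := 1) (by norm_num)).differentiable (by simp)

theorem pullback_coordForm {a b : ℕ} (f : Vec a → Vec b) (c : Fin a → Fin b) (x : Vec a)
    (v : Fin a → Vec a) : pullback f (coordForm c) x v =
      Matrix.det (Matrix.of fun i j : Fin a => fderiv ℝ f x (basisVec i) (c j)) *
        baseVol x v := by
  rw [baseVol, mul_comm, ← Matrix.det_mul, pullback, coordForm]
  congr 1
  ext i j
  have : v i = ∑ l, v i l • (basisVec l : Vec a) := by
    ext t; simp [basisVec, Pi.single_apply]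
  conv_lhs => rw [Matrix.of_apply, this]
  simp [Matrix.mul_apply]

theorem differentiableAt_jet {φ : Vec 4 → ℝ} (hφ : ContDiff ℝ (⊤ : ℕ∞) φ) (x : Vec 4) :
    DifferentiableAt ℝ (jet φ) x := by
  rw [differentiableAt_pi]
  intro i
  unfold jet
  have := hφ.differentiable (by simp)
  have h2 : Differentiable ℝ (fderiv ℝ φ) := differentiable_fderiv hφ
  split_ifs <;> fun_prop

theorem fderiv_jet_apply {φ : Vec 4 → ℝ} (hφ : ContDiff ℝ (⊤ : ℕ∞) φ) (x v : Vec 4) (i : Fin (2 * 4 + 1)) :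
    fderiv ℝ (jet φ) x v i = fderiv ℝ (fun y => jet φ y i) x v := by
  exact (congrArg (· v) (hasFDerivAt_pi'.1 (differentiableAt_jet hφ x).hasFDerivAt i).fderiv).symm

theorem fderiv_jet_qIdx {φ : Vec 4 → ℝ} (hφ : ContDiff ℝ (⊤ : ℕ∞) φ) (x v : Vec 4) (μ : Fin 4) :
    fderiv ℝ (jet φ) x v (qIdx μ) = v μ := by
  rw [fderiv_jet_apply hφ]
  simp [jet, qIdx, fderiv_apply]

theorem fderiv_jet_pIdx {φ : Vec 4 → ℝ} (hφ : ContDiff ℝ (⊤ : ℕ∞) φ) (x : Vec 4) (μ ν : Fin 4) :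
    fderiv ℝ (jet φ) x (basisVec μ) (pIdx ν) = d2 φ μ ν x := by
  rw [fderiv_jet_apply hφ]
  have h (y : Vec 4) : jet φ y (pIdx ν) = fderiv ℝ φ y (basisVec ν) := by
    have h4 : ¬ 5 + (ν : ℕ) < 4 := by omega
    have h5 : 5 + (ν : ℕ) ≠ 4 := by omega
    simp [jet, pIdx, h4, h5]
  simp [h, d2]

theorem d2_comm {φ : Vec 4 → ℝ} (hφ : ContDiff ℝ (⊤ : ℕ∞) φ) (x : Vec 4) (μ ν : Fin 4) :
    d2 φ μ ν x = d2 φ ν μ x := by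
  have h2 : Differentiable ℝ (fderiv ℝ φ) := differentiable_fderiv hφ
  have e (a b : Fin 4) : d2 φ a b x = fderiv ℝ (fderiv ℝ φ) x (basisVec a) (basisVec b) := by
    rw [d2, fderiv_clm_apply (h2 x) (by fun_prop)]
    simp
  rw [e, e]
  exact ((contDiff_infty.1 hφ 2).contDiffAt.isSymmSndFDerivAt (by simp)).eq _ _

theorem pullback_jet_omegaH {φ : Vec 4 → ℝ} (hφ : ContDiff ℝ (⊤ : ℕ∞) φ) :
    pullback (jet φ) omegaH =
      fsmul (fun x => d2 φ 0 2 x * d2 φ 1 3 x - d2 φ 0 3 x * d2 φ 1 2 x +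
        d2 φ 0 0 x + d2 φ 1 1 x) baseVol := by
  funext x v
  have e (i j k l : Fin (2 * 4 + 1)) :
      dd i j k l (jet φ x) (fun i => fderiv ℝ (jet φ) x (v i)) =
        coordForm ![i, j, k, l] (jet φ x) (fun i => fderiv ℝ (jet φ) x (basisVec i)) * baseVol x v := by
    rw [dd_eq_coordForm]
    exact pullback_coordForm (jet φ) ![i, j, k, l] x v
  simp only [pullback, omegaH, Pi.add_apply, Pi.sub_apply, Pi.smul_apply, e, coordForm_four,
    fderiv_jet_qIdx hφ, fderiv_jet_pIdx hφ, fsmul, smul_eq_mul]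
  rw [d2_comm hφ x 1 0, d2_comm hφ x 2 0, d2_comm hφ x 3 0, d2_comm hφ x 2 1, d2_comm hφ x 3 1,
    d2_comm hφ x 3 2]
  simp [basisVec]
  ring

/-- A tangent vector is vertical if it has no component along the base coordinates `q`. -/
def IsVertical {n : ℕ} (w : Vec (2 * n + 1)) : Prop := ∀ μ : Fin n, w (qIdx μ) = 0

/-- `ω` vanishes as soon as at least `r` of its arguments are vertical. -/
def VanishesOnVertical {n k : ℕ} (r : ℕ) (ω : Form (2 * n + 1) k) : Prop :=
  ∀ x v (s : Finset (Fin k)), r ≤ s.card → (∀ i ∈ s, IsVertical (v i)) → ω x v = 0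

theorem isVertical_basisVec_pIdx {n : ℕ} (μ : Fin n) :
    IsVertical (basisVec (pIdx μ) : Vec (2 * n + 1)) := by
  intro ν
  have h : (qIdx ν : Fin (2 * n + 1)) ≠ pIdx μ := by
    simp only [ne_eq, qIdx, pIdx, Fin.mk.injEq]
    omega
  simp [basisVec, h]

theorem isVertical_chi {n : ℕ} : IsVertical (chi : Vec (2 * n + 1)) := by
  intro ν
  have h : (qIdx ν : Fin (2 * n + 1)) ≠ uIdx := by
    simp only [ne_eq, qIdx, uIdx, Fin.mk.injEq]
    omega
  simp [chi, basisVec, h]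

theorem card_le_card_preimage_add_one {α β : Type*} [Fintype α] [DecidableEq β] (f : α → β) (b : β)
    (hf : ∀ c, c = b ∨ ∃ a, f a = c) (s : Finset β) :
    s.card ≤ (Finset.univ.filter fun a => f a ∈ s).card + 1 := by
  have hs : s ⊆ insert b ((Finset.univ.filter fun a => f a ∈ s).image f) := by
    intro c hc
    rcases hf c with rfl | ⟨a, rfl⟩
    · simp
    · exact Finset.mem_insert_of_mem (Finset.mem_image_of_mem f (by simpa using hc))
  calc s.card ≤ _ := Finset.card_le_card hs
    _ ≤ _ := Finset.card_insert_le _ _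
    _ ≤ _ := Nat.add_le_add_right Finset.card_image_le 1

namespace VanishesOnVertical

variable {n k r : ℕ} {ω η : Form (2 * n + 1) k}

theorem add (hω : VanishesOnVertical r ω) (hη : VanishesOnVertical r η) :
    VanishesOnVertical r (ω + η) := fun x v s hs hv => by
  simp [hω x v s hs hv, hη x v s hs hv]

theorem sub (hω : VanishesOnVertical r ω) (hη : VanishesOnVertical r η) :
    VanishesOnVertical r (ω - η) := fun x v s hs hv => by
  simp [hω x v s hs hv, hη x v s hs hv]

theorem mono {t : ℕ} (hω : VanishesOnVertical r ω) (h : r ≤ t) : VanishesOnVertical t ω :=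
  fun x v s hs => hω x v s (h.trans hs)

theorem fsmul_qvol (L : Vec (2 * n + 1) → ℝ) : VanishesOnVertical 1 (fsmul L qvol) := by
  intro x v s hs hv
  obtain ⟨i, hi⟩ := Finset.card_pos.1 hs
  have h0 : qvol x v = 0 := Matrix.det_eq_zero_of_row_eq_zero i fun j => hv i hi j
  simp [fsmul, h0]

theorem exd (hω : VanishesOnVertical r ω) : VanishesOnVertical (r + 1) (exd ω) := by
  intro x v s hs hv
  refine Finset.sum_eq_zero fun i _ => ?_
  have h0 : (fun y => ω y fun j => v (i.succAbove j)) = fun _ => 0 := by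
    funext y
    refine hω y _ (Finset.univ.filter fun j => i.succAbove j ∈ s) ?_ ?_
    · have := card_le_card_preimage_add_one i.succAbove i
        (fun c => (eq_or_ne c i).imp_right fun h => Fin.exists_succAbove_eq h) s
      omega
    · intro j hj
      exact hv _ (by simpa using hj)
  simp [h0]

theorem lieChi (hω : VanishesOnVertical r ω) : VanishesOnVertical r (lieChi ω) := by
  intro x v s hs hv
  have h0 : (fun y => ω y v) = fun _ => 0 := funext fun y => hω y v s hs hv
  simp [MA.lieChi, h0]

theorem reindex {l : ℕ} (h : k = l) (hω : VanishesOnVertical r ω) :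
    VanishesOnVertical r (reindex h ω) := by
  subst h
  exact hω

theorem iprod (u : Vec (2 * n + 1)) (hω : VanishesOnVertical r ω) :
    VanishesOnVertical r (iprod u ω) := by
  intro x v s hs hv
  cases k with
  | zero => rfl
  | succ k =>
    refine hω x _ (s.map (Fin.succEmb k)) (by simpa using hs) ?_
    simpa using hv

theorem iprod_of_isVertical {u : Vec (2 * n + 1)} (hu : IsVertical u)
    (hω : VanishesOnVertical (r + 1) ω) : VanishesOnVertical r (MA.iprod u ω) := by
  intro x v s hs hv
  cases k with
  | zero => rfl
  | succ k =>
    refine hω x _ (Finset.cons 0 (s.map (Fin.succEmb k)) (by simp)) (by simpa using hs) ?_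
    simpa [hu] using hv

theorem botOp (hω : VanishesOnVertical (r + 1) ω) : VanishesOnVertical r (botOp ω) := by
  intro x v s hs hv
  rw [MA.botOp, Finset.sum_apply, Finset.sum_apply]
  exact Finset.sum_eq_zero fun μ _ =>
    (hω.iprod _).iprod_of_isVertical (isVertical_basisVec_pIdx μ) x v s hs hv

theorem wedge_left (α : Form (2 * n + 1) 1) (hω : VanishesOnVertical r ω) :
    VanishesOnVertical (r + 1) (wedge α ω) := by
  intro x v s hs hv
  rw [wedge, Finset.sum_eq_zero, mul_zero]
  intro σ _
  rw [hω x _ (Finset.univ.filter fun j => σ (Fin.natAdd 1 j) ∈ s), mul_zero]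
  · have := card_le_card_preimage_add_one (fun j => σ (Fin.natAdd 1 j)) (σ (Fin.castAdd k 0))
      (fun c => by
        obtain ⟨d, rfl⟩ := σ.surjective c
        induction d using Fin.addCases with
        | left i => exact Or.inl (by rw [Subsingleton.elim i 0])
        | right j => exact Or.inr ⟨j, rfl⟩) s
    omega
  · intro j hj
    exact hv _ (by simpa using hj)

theorem dproj (hω : VanishesOnVertical r ω) : VanishesOnVertical (r + 1) (dproj ω) :=
  hω.exd.sub ((hω.exd.iprod_of_isVertical isVertical_chi).wedge_left contact |>.reindex _)

end VanishesOnVertical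

/-- The Euler operator of a Lagrangian form is at most linear in the vertical directions. -/
theorem vanishesOnVertical_euler {n : ℕ} (L : Vec (2 * n + 1) → ℝ) :
    VanishesOnVertical 2 (euler (fsmul L qvol)) := by
  have hL : VanishesOnVertical 1 (fsmul L (qvol (n := n))) := .fsmul_qvol L
  cases n with
  | zero => exact hL.lieChi.mono one_le_two
  | succ n => exact (hL.dproj.botOp.dproj.reindex _).add (hL.lieChi.mono one_le_two)

theorem omegaH_apply_basisVec (x : Vec (2 * 4 + 1)) :
    omegaH x ![basisVec (qIdx 0), basisVec (qIdx 1), basisVec (pIdx 0), basisVec (pIdx 1)] =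
      1 / 3 := by
  simp [omegaH, dd_eq_coordForm, coordForm_four, basisVec, qIdx, pIdx]

/-- the displayed effective 4-form represents the Husain equation
`φ₁₃φ₂₄ − φ₁₄φ₂₃ + φ₁₁ + φ₂₂ = 0`, and this equation is not the Euler–Lagrange equation
of any first-order Lagrangian. -/
theorem husain_equation_not_variational :
    (Effective omegaH ∧
      ∀ φ : Vec 4 → ℝ, ContDiff ℝ (⊤ : ℕ∞) φ →
        pullback (jet φ) omegaH =
          fsmul (fun x => d2 φ 0 2 x * d2 φ 1 3 x - d2 φ 0 3 x * d2 φ 1 2 x +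
            d2 φ 0 0 x + d2 φ 1 1 x) baseVol) ∧
    ¬ ∃ (L k : Vec (2 * 4 + 1) → ℝ), ContDiff ℝ (⊤ : ℕ∞) L ∧ ContDiff ℝ (⊤ : ℕ∞) k ∧ (∀ x, k x ≠ 0) ∧
        fsmul k omegaH = euler (fsmul L qvol) := by
  refine ⟨⟨⟨iprod_chi_omegaH, botOp_omegaH⟩, fun φ hφ => pullback_jet_omegaH hφ⟩, ?_⟩
  rintro ⟨L, k, -, -, hk, h⟩
  have h0 := congrFun (congrFun h 0)
    ![basisVec (qIdx 0), basisVec (qIdx 1), basisVec (pIdx 0), basisVec (pIdx 1)]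
  rw [fsmul, omegaH_apply_basisVec, vanishesOnVertical_euler L 0 _ {2, 3} (by simp)] at h0
  · exact hk 0 (by linarith)
  · simpa using ⟨isVertical_basisVec_pIdx (0 : Fin 4), isVertical_basisVec_pIdx (1 : Fin 4)⟩

end MA
end
end

section
/- Let ω = −dq¹∧dq²∧dq³∧dq⁴ + (1/3)(dq¹∧dq²∧dp₁∧dp₂ + dq³∧dq⁴∧dp₃∧dp₄) − (1/6)(dq¹∧dq³∧dp₁∧dp₃ + dq¹∧dq⁴∧dp₁∧dp₄ + dq²∧dq³∧dp₂∧dp₃ + dq²∧dq⁴∧dp₂∧dp₄) be the effective 4-form on ℝ⁹ representing the first heavenly equation of Plebański. Then the 5-form m = de ∧ β + c ∧ ω on ℝ¹⁰ (coordinates (q¹,…,q⁴,u,p₁,…,p₄,e)) is multisymplectic: dm = 0 and, at every point, the only tangent vector v with v ⌟ m = 0 is v = 0. -/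
noncomputable section

namespace MA

/-- The effective 4-form on ℝ⁹ representing the first heavenly equation of Plebański. -/
def omegaP1 : Form (2 * 4 + 1) 4 :=
  -(dd (qIdx 0) (qIdx 1) (qIdx 2) (qIdx 3)) +
    (1 / 3 : ℝ) • (dd (qIdx 0) (qIdx 1) (pIdx 0) (pIdx 1) +
      dd (qIdx 2) (qIdx 3) (pIdx 2) (pIdx 3)) -
    (1 / 6 : ℝ) • (dd (qIdx 0) (qIdx 2) (pIdx 0) (pIdx 2) +
      dd (qIdx 0) (qIdx 3) (pIdx 0) (pIdx 3) +
      dd (qIdx 1) (qIdx 2) (pIdx 1) (pIdx 2) +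
      dd (qIdx 1) (qIdx 3) (pIdx 1) (pIdx 3))

/-- The determinant `f₀ ∧ ⋯ ∧ fₖ₋₁` of `k` covectors evaluated on `k` vectors. -/
def covDet {m k : ℕ} (f : Fin k → Vec m → ℝ) (v : Fin k → Vec m) : ℝ :=
  Matrix.det (Matrix.of fun i j => f j (v i))

/-- The coordinate covectors with the given indices. -/
def coords {m k : ℕ} (s : Fin k → Fin m) : Fin k → Vec m → ℝ := fun j w => w (s j)

/-- The covector of the contact form at the point `x`, lifted to ℝ^{2n+2}. -/
def contactCov {n : ℕ} (x w : Vec (2 * n + 1 + 1)) : ℝ :=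
  w uIdx.castSucc - ∑ μ : Fin n, x (pIdx μ).castSucc * w (qIdx μ).castSucc

lemma covDet_cons {m k : ℕ} (g : Vec m → ℝ) (f : Fin k → Vec m → ℝ) (v : Fin (k + 1) → Vec m) :
    covDet (Fin.cons g f : Fin (k + 1) → Vec m → ℝ) v =
      ∑ i : Fin (k + 1), (-1 : ℝ) ^ (i : ℕ) * g (v i) * covDet f (fun j => v (i.succAbove j)) := by
  simp only [covDet, Matrix.det_succ_column_zero]
  rfl

lemma coords_cons {m k : ℕ} (i : Fin m) (s : Fin k → Fin m) :
    coords (Fin.cons i s : Fin (k + 1) → Fin m) = Fin.cons (fun w => w i) (coords s) := by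
  funext j
  refine Fin.cases ?_ (fun _ => ?_) j <;> rfl

lemma covDet_append_one {m k : ℕ} (h : 1 + k = k + 1) (g : Vec m → ℝ) (f : Fin k → Vec m → ℝ)
    (v : Fin (k + 1) → Vec m) :
    covDet (Fin.append (fun _ : Fin 1 => g) f) (fun i => v (Fin.cast h i)) =
      covDet (Fin.cons g f : Fin (k + 1) → Vec m → ℝ) v := by
  rw [covDet, covDet, ← Matrix.det_submatrix_equiv_self (finCongr h)]
  congr 1
  ext i j
  refine Fin.addCases (fun a => ?_) (fun a => ?_) j
  · obtain rfl : a = 0 := Subsingleton.elim _ _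
    simp only [Matrix.of_apply, Matrix.submatrix_apply, Fin.append_left]
    rfl
  · have ha : Fin.cast h (Fin.natAdd 1 a) = a.succ := Fin.ext (Nat.add_comm 1 a)
    simp [ha]

lemma covDet_coords_perm {m k : ℕ} (s : Fin k → Fin m) (σ : Equiv.Perm (Fin k))
    (v : Fin k → Vec m) :
    covDet (coords (s ∘ σ)) v = ((Equiv.Perm.sign σ : ℤ) : ℝ) * covDet (coords s) v :=
  Matrix.det_permute' σ (Matrix.of fun i j => coords s j (v i))

lemma covDet_coords_eq_zero {m k : ℕ} (s : Fin k → Fin m) (v : Fin k → Vec m) (i j : Fin k)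
    (hij : i ≠ j) (h : s i = s j) : covDet (coords s) v = 0 :=
  Matrix.det_zero_of_column_eq hij fun a => by simp [coords, h]

lemma sum_perm_sign_mul_prod {N : ℕ} (M : Matrix (Fin N) (Fin N) ℝ) (π : Equiv.Perm (Fin N)) :
    ∑ σ : Equiv.Perm (Fin N), ((Equiv.Perm.sign σ : ℤ) : ℝ) *
      (((Equiv.Perm.sign π : ℤ) : ℝ) * ∏ j, M (σ (π j)) j) = M.det := by
  rw [Matrix.det_apply', ← Equiv.sum_comp (Equiv.mulRight π) fun σ =>
    ((Equiv.Perm.sign σ : ℤ) : ℝ) * ∏ j, M (σ j) j]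
  refine Finset.sum_congr rfl fun σ _ => ?_
  rcases Int.units_eq_one_or (Equiv.Perm.sign π) with h | h <;> simp [h]

lemma sum_perm_sign_mul_det_mul_det {k l : ℕ} (M : Matrix (Fin (k + l)) (Fin (k + l)) ℝ) :
    ∑ σ : Equiv.Perm (Fin (k + l)), ((Equiv.Perm.sign σ : ℤ) : ℝ) *
      (Matrix.of fun i j => M (σ (Fin.castAdd l i)) (Fin.castAdd l j)).det *
      (Matrix.of fun i j => M (σ (Fin.natAdd k i)) (Fin.natAdd k j)).det =
    ((k.factorial * l.factorial : ℕ) : ℝ) * M.det := by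
  have key : ∀ σ : Equiv.Perm (Fin (k + l)), ((Equiv.Perm.sign σ : ℤ) : ℝ) *
      (Matrix.of fun i j => M (σ (Fin.castAdd l i)) (Fin.castAdd l j)).det *
      (Matrix.of fun i j => M (σ (Fin.natAdd k i)) (Fin.natAdd k j)).det =
      ∑ τ : Equiv.Perm (Fin k), ∑ ρ : Equiv.Perm (Fin l), ((Equiv.Perm.sign σ : ℤ) : ℝ) *
        (((Equiv.Perm.sign (finSumFinEquiv.permCongr (Equiv.Perm.sumCongr τ ρ)) : ℤ) : ℝ) *
          ∏ j, M (σ (finSumFinEquiv.permCongr (Equiv.Perm.sumCongr τ ρ) j)) j) := by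
    intro σ
    rw [Matrix.det_apply', Matrix.det_apply', mul_assoc, Finset.sum_mul_sum, Finset.mul_sum]
    refine Finset.sum_congr rfl fun τ _ => ?_
    rw [Finset.mul_sum]
    refine Finset.sum_congr rfl fun ρ _ => ?_
    rw [Fin.prod_univ_add]
    simp [Equiv.permCongr_apply]
    ring
  rw [Finset.sum_congr rfl fun σ _ => key σ, Finset.sum_comm]
  rw [Finset.sum_congr rfl fun τ _ => Finset.sum_comm]
  simp only [sum_perm_sign_mul_prod]
  simp [Fintype.card_perm, mul_assoc]

lemma wedge_eq_covDet {m k l : ℕ} {ω : Form m k} {η : Form m l} {x : Vec m}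
    {f : Fin k → Vec m → ℝ} {g : Fin l → Vec m → ℝ} (hω : ω x = covDet f) (hη : η x = covDet g) :
    wedge ω η x = covDet (Fin.append f g) := by
  funext v
  have h := sum_perm_sign_mul_det_mul_det (Matrix.of fun i j => Fin.append f g j (v i))
  simp only [Matrix.of_apply, Fin.append_left, Fin.append_right] at h
  simp only [wedge, hω, hη, covDet]
  rw [h, inv_mul_cancel_left₀]
  exact_mod_cast (Nat.mul_pos k.factorial_pos l.factorial_pos).ne'

lemma eq_covDet_of_one {m : ℕ} {ω : Form m 1} {x : Vec m} {g : Vec m → ℝ}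
    (h : ∀ v, ω x v = g (v 0)) : ω x = covDet (fun _ => g) := by
  funext v
  simp [covDet, h]

lemma wedge_add_right {m k l : ℕ} (ω : Form m k) (η θ : Form m l) :
    wedge ω (η + θ) = wedge ω η + wedge ω θ := by
  funext x v
  simp [wedge, mul_add, Finset.sum_add_distrib]

lemma wedge_smul_right {m k l : ℕ} (ω : Form m k) (a : ℝ) (η : Form m l) :
    wedge ω (a • η) = a • wedge ω η := by
  funext x v
  simp only [wedge, Pi.smul_apply, smul_eq_mul, Finset.mul_sum]
  exact Finset.sum_congr rfl fun σ _ => by ring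

lemma wedge_sum_right {m k l : ℕ} {ι : Type*} (s : Finset ι) (ω : Form m k) (η : ι → Form m l) :
    wedge ω (∑ t ∈ s, η t) = ∑ t ∈ s, wedge ω (η t) := by
  refine map_sum (AddMonoidHom.mk' (wedge ω) (wedge_add_right ω)) η s

lemma liftForm_apply {n k : ℕ} (ω : Form (2 * n + 1) k) (x : Vec (2 * n + 1 + 1))
    (v : Fin k → Vec (2 * n + 1 + 1)) :
    liftForm ω x v = ω (fun i => x i.castSucc) (fun j i => v j i.castSucc) := by
  have h : fderiv ℝ (fun (y : Vec (2 * n + 1 + 1)) (i : Fin (2 * n + 1)) => y i.castSucc) x =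
      ContinuousLinearMap.pi fun i => ContinuousLinearMap.proj i.castSucc :=
    (ContinuousLinearMap.pi fun i : Fin (2 * n + 1) =>
      (ContinuousLinearMap.proj i.castSucc : Vec (2 * n + 1 + 1) →L[ℝ] ℝ)).fderiv
  simp only [liftForm, pullback, h]
  rfl

lemma dd_eq_covDet (i j k l : Fin (2 * 4 + 1)) (x : Vec (2 * 4 + 1)) :
    dd i j k l x = covDet (coords ![i, j, k, l]) := by
  have h (i : Fin (2 * 4 + 1)) : dx i x = covDet (fun _ w => w i) := eq_covDet_of_one fun _ => rfl
  rw [dd, wedge_eq_covDet (wedge_eq_covDet (wedge_eq_covDet (h i) (h j)) (h k)) (h l)]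
  congr 1
  funext a
  fin_cases a <;> rfl

/-- The coefficients of `omegaP1`. -/
def heavenlyCoeff : Fin 7 → ℝ := ![-1, 1 / 3, 1 / 3, -1 / 6, -1 / 6, -1 / 6, -1 / 6]

/-- The coordinate monomials of `omegaP1`. -/
def heavenlyIdx : Fin 7 → Fin 4 → Fin (2 * 4 + 1) :=
  ![![qIdx 0, qIdx 1, qIdx 2, qIdx 3],
    ![qIdx 0, qIdx 1, pIdx 0, pIdx 1],
    ![qIdx 2, qIdx 3, pIdx 2, pIdx 3],
    ![qIdx 0, qIdx 2, pIdx 0, pIdx 2],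
    ![qIdx 0, qIdx 3, pIdx 0, pIdx 3],
    ![qIdx 1, qIdx 2, pIdx 1, pIdx 2],
    ![qIdx 1, qIdx 3, pIdx 1, pIdx 3]]

lemma omegaP1_apply (x : Vec (2 * 4 + 1)) (v : Fin 4 → Vec (2 * 4 + 1)) :
    omegaP1 x v = ∑ t, heavenlyCoeff t * covDet (coords (heavenlyIdx t)) v := by
  simp [omegaP1, dd_eq_covDet, heavenlyCoeff, heavenlyIdx, Fin.sum_univ_succ]
  ring

lemma msf_omegaP1_apply (x : Vec (2 * 4 + 1 + 1)) (v : Fin 5 → Vec (2 * 4 + 1 + 1)) :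
    msf omegaP1 x v =
      covDet (coords (Fin.cons (Fin.last 9) fun μ => (qIdx (n := 4) μ).castSucc)) v +
      ∑ t, heavenlyCoeff t *
        covDet (Fin.cons (contactCov (n := 4) x) (coords fun j => (heavenlyIdx t j).castSucc)) v := by
  have hω : liftForm omegaP1 = ∑ t, heavenlyCoeff t •
      ((fun _ => covDet (coords fun j => (heavenlyIdx t j).castSucc)) :
        Form (2 * 4 + 1 + 1) 4) := by
    funext y w
    simp only [liftForm_apply, omegaP1_apply, Finset.sum_apply, Pi.smul_apply, smul_eq_mul]
    rfl
  have hc : liftForm (contact (n := 4)) x = covDet fun _ => contactCov (n := 4) x :=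
    eq_covDet_of_one fun w => by rw [liftForm_apply]; rfl
  have he : deForm (n := 4) x = covDet fun _ w => w (Fin.last 9) := eq_covDet_of_one fun _ => rfl
  have hβ : liftForm (qvol (n := 4)) x = covDet (coords fun μ => (qIdx (n := 4) μ).castSucc) := by
    funext w
    rw [liftForm_apply]
    rfl
  simp only [msf, Pi.add_apply, reindex, hω, wedge_sum_right, wedge_smul_right, Finset.sum_apply,
    Pi.smul_apply, smul_eq_mul, wedge_eq_covDet he hβ]
  refine congrArg₂ (· + ·) ?_ (Finset.sum_congr rfl fun t _ => ?_)
  · rw [coords_cons]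
    exact covDet_append_one _ _ _ v
  · rw [wedge_eq_covDet hc rfl]
    exact congrArg _ (covDet_append_one _ _ _ v)

lemma covDet_cons_contactCov {n k : ℕ} (x : Vec (2 * n + 1 + 1))
    (s : Fin k → Fin (2 * n + 1 + 1)) (v : Fin (k + 1) → Vec (2 * n + 1 + 1)) :
    covDet (Fin.cons (contactCov x) (coords s)) v =
      covDet (Fin.cons (fun w => w uIdx.castSucc) (coords s)) v -
        ∑ μ : Fin n, x (pIdx μ).castSucc *
          covDet (Fin.cons (fun w => w (qIdx μ).castSucc) (coords s)) v := by
  simp only [covDet_cons, contactCov, mul_sub, sub_mul, Finset.sum_sub_distrib, Finset.mul_sum,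
    Finset.sum_mul]
  rw [Finset.sum_comm]
  congr 1
  exact Finset.sum_congr rfl fun μ _ => Finset.sum_congr rfl fun i _ => by ring

lemma fderiv_msf_omegaP1 (x w : Vec (2 * 4 + 1 + 1)) (v : Fin 5 → Vec (2 * 4 + 1 + 1)) :
    fderiv ℝ (fun y => msf omegaP1 y v) x w =
      -∑ t, heavenlyCoeff t * ∑ μ : Fin 4, w (pIdx μ).castSucc *
        covDet (Fin.cons (fun w => w (qIdx μ).castSucc)
          (coords fun j => (heavenlyIdx t j).castSucc)) v := by
  simp only [msf_omegaP1_apply, covDet_cons_contactCov]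
  set A := covDet (coords (Fin.cons (Fin.last 9) fun μ => (qIdx (n := 4) μ).castSucc)) v
  have hp (i : Fin (2 * 4 + 1 + 1)) : HasFDerivAt (fun y : Vec (2 * 4 + 1 + 1) => y i)
      (ContinuousLinearMap.proj i : Vec (2 * 4 + 1 + 1) →L[ℝ] ℝ) x :=
    (ContinuousLinearMap.proj i : Vec (2 * 4 + 1 + 1) →L[ℝ] ℝ).hasFDerivAt
  have h := (HasFDerivAt.fun_sum (u := Finset.univ) fun t _ =>
    ((HasFDerivAt.fun_sum (u := Finset.univ) fun (μ : Fin 4) _ =>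
      (hp (pIdx μ).castSucc).mul_const
        (covDet (Fin.cons (fun w => w (qIdx μ).castSucc)
          (coords fun j => (heavenlyIdx t j).castSucc)) v)).const_sub
      (covDet (Fin.cons (fun w => w uIdx.castSucc)
          (coords fun j => (heavenlyIdx t j).castSucc)) v)).const_mul (heavenlyCoeff t)).const_add A
  rw [h.fderiv]
  simp [mul_comm]

lemma exd_msf_omegaP1_apply (x : Vec (2 * 4 + 1 + 1)) (v : Fin 6 → Vec (2 * 4 + 1 + 1)) :
    exd (msf omegaP1) x v = -∑ t, heavenlyCoeff t * ∑ μ : Fin 4,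
      covDet (coords (Fin.cons (pIdx μ).castSucc (Fin.cons (qIdx μ).castSucc
        fun j => (heavenlyIdx t j).castSucc))) v := by
  simp only [exd, fderiv_msf_omegaP1, coords_cons]
  simp only [covDet_cons (m := 2 * 4 + 1 + 1) (k := 5), mul_neg, Finset.sum_neg_distrib,
    Finset.mul_sum]
  rw [Finset.sum_comm]
  congr 1
  refine Finset.sum_congr rfl fun t _ => ?_
  rw [Finset.sum_comm]
  exact Finset.sum_congr rfl fun μ _ => Finset.sum_congr rfl fun i _ => by ring

lemma exd_msf_omegaP1 : exd (msf omegaP1) = 0 := by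
  funext x v
  set F : Fin 4 → Fin 4 → Fin 4 → ℝ := fun μ i j =>
    covDet (coords ![(pIdx (n := 4) μ).castSucc, (qIdx (n := 4) μ).castSucc,
      (qIdx (n := 4) i).castSucc, (qIdx (n := 4) j).castSucc,
      (pIdx (n := 4) i).castSucc, (pIdx (n := 4) j).castSucc]) v with hF
  have hl (μ j : Fin 4) : F μ μ j = 0 := covDet_coords_eq_zero _ _ 0 4 (by decide) rfl
  have hr (μ i : Fin 4) : F μ i μ = 0 := covDet_coords_eq_zero _ _ 0 5 (by decide) rfl
  have swapL (μ i j : Fin 4) : F μ i j = F i μ j := by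
    have h := covDet_coords_perm ![(pIdx (n := 4) μ).castSucc, (qIdx (n := 4) μ).castSucc,
      (qIdx (n := 4) i).castSucc, (qIdx (n := 4) j).castSucc,
      (pIdx (n := 4) i).castSucc, (pIdx (n := 4) j).castSucc]
      (Equiv.swap 0 4 * Equiv.swap 1 2) v
    have hs : Equiv.Perm.sign (Equiv.swap (0 : Fin 6) 4 * Equiv.swap 1 2) = 1 := by decide
    rw [hs, Units.val_one, Int.cast_one, one_mul] at h
    rw [hF]
    simp only
    rw [← h]
    congr 2
    funext a
    fin_cases a <;> rfl
  have swapR (μ i j : Fin 4) : F μ i j = F μ j i := by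
    have h := covDet_coords_perm ![(pIdx (n := 4) μ).castSucc, (qIdx (n := 4) μ).castSucc,
      (qIdx (n := 4) i).castSucc, (qIdx (n := 4) j).castSucc,
      (pIdx (n := 4) i).castSucc, (pIdx (n := 4) j).castSucc]
      (Equiv.swap 2 3 * Equiv.swap 4 5) v
    have hs : Equiv.Perm.sign (Equiv.swap (2 : Fin 6) 3 * Equiv.swap 4 5) = 1 := by decide
    rw [hs, Units.val_one, Int.cast_one, one_mul] at h
    rw [hF]
    simp only
    rw [← h]
    congr 2
    funext a
    fin_cases a <;> rfl
  have hvol (μ : Fin 4) : covDet (coords (Fin.cons (pIdx (n := 4) μ).castSucc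
      (Fin.cons (qIdx (n := 4) μ).castSucc fun j => (heavenlyIdx 0 j).castSucc))) v = 0 := by
    refine covDet_coords_eq_zero _ _ 1 μ.succ.succ (by fin_cases μ <;> decide) ?_
    fin_cases μ <;> rfl
  have hmono (t : Fin 7) (i j : Fin 4)
      (h : heavenlyIdx t = ![qIdx i, qIdx j, pIdx i, pIdx j]) (μ : Fin 4) :
      covDet (coords (Fin.cons (pIdx (n := 4) μ).castSucc
        (Fin.cons (qIdx (n := 4) μ).castSucc fun j => (heavenlyIdx t j).castSucc))) v =
        F μ i j := by
    rw [h, hF]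
    simp only
    congr 2
    funext a
    fin_cases a <;> rfl
  have e (t : Fin 7) (i j : Fin 4) (h : heavenlyIdx t = ![qIdx i, qIdx j, pIdx i, pIdx j]) :=
    Finset.sum_congr (s₁ := Finset.univ) rfl fun μ _ => hmono t i j h μ
  rw [exd_msf_omegaP1_apply, Fin.sum_univ_seven, Finset.sum_congr rfl fun μ _ => hvol μ,
    e 1 0 1 rfl, e 2 2 3 rfl, e 3 0 2 rfl, e 4 0 3 rfl, e 5 1 2 rfl, e 6 1 3 rfl]
  simp only [Fin.sum_univ_four, hl, hr, heavenlyCoeff]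
  rw [swapL 2 0 1, swapR 0 2 1, swapL 1 0 2, swapL 3 0 1, swapR 0 3 1, swapL 1 0 3,
    swapL 3 0 2, swapR 0 3 2, swapL 2 0 3, swapL 3 1 2, swapR 1 3 2, swapL 2 1 3]
  simp
  ring

lemma msf_omegaP1_apply_explicit (x : Vec (2 * 4 + 1 + 1)) (v : Fin 5 → Vec (2 * 4 + 1 + 1)) :
    msf omegaP1 x v =
      covDet ![fun w => w 9, fun w => w 0, fun w => w 1, fun w => w 2, fun w => w 3] v -
      covDet ![contactCov (n := 4) x, fun w => w 0, fun w => w 1, fun w => w 2, fun w => w 3] v +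
      1 / 3 * covDet ![contactCov (n := 4) x,
        fun w => w 0, fun w => w 1, fun w => w 5, fun w => w 6] v +
      1 / 3 * covDet ![contactCov (n := 4) x,
        fun w => w 2, fun w => w 3, fun w => w 7, fun w => w 8] v -
      1 / 6 * covDet ![contactCov (n := 4) x,
        fun w => w 0, fun w => w 2, fun w => w 5, fun w => w 7] v -
      1 / 6 * covDet ![contactCov (n := 4) x,
        fun w => w 0, fun w => w 3, fun w => w 5, fun w => w 8] v -
      1 / 6 * covDet ![contactCov (n := 4) x,
        fun w => w 1, fun w => w 2, fun w => w 6, fun w => w 7] v -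
      1 / 6 * covDet ![contactCov (n := 4) x,
        fun w => w 1, fun w => w 3, fun w => w 6, fun w => w 8] v := by
  have h0 : (coords (Fin.cons (Fin.last 9) fun μ => (qIdx (n := 4) μ).castSucc) :
      Fin 5 → Vec (2 * 4 + 1 + 1) → ℝ) =
      ![fun w => w 9, fun w => w 0, fun w => w 1, fun w => w 2, fun w => w 3] := by
    funext a
    fin_cases a <;> rfl
  have h (t : Fin 7) : (Fin.cons (contactCov (n := 4) x)
      (coords fun j => (heavenlyIdx t j).castSucc) : Fin 5 → Vec (2 * 4 + 1 + 1) → ℝ) =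
      ![contactCov (n := 4) x, fun w => w (heavenlyIdx t 0).castSucc,
        fun w => w (heavenlyIdx t 1).castSucc, fun w => w (heavenlyIdx t 2).castSucc,
        fun w => w (heavenlyIdx t 3).castSucc] := by
    funext a
    fin_cases a <;> rfl
  simp only [msf_omegaP1_apply, h0, h, Fin.sum_univ_seven]
  simp [heavenlyCoeff, heavenlyIdx, qIdx, pIdx]
  ring

lemma contactCov_apply (x w : Vec (2 * 4 + 1 + 1)) : contactCov (n := 4) x w =
    w 4 - (x 5 * w 0 + x 6 * w 1 + x 7 * w 2 + x 8 * w 3) := by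
  simp [contactCov, Fin.sum_univ_four, qIdx, pIdx, uIdx]

lemma covDet_three {m : ℕ} (a b c : Vec m → ℝ) (u v w : Vec m) :
    covDet ![a, b, c] ![u, v, w] = a u * (b v * c w - c v * b w) -
      b u * (a v * c w - c v * a w) + c u * (a v * b w - b v * a w) := by
  simp [covDet, Matrix.det_fin_three]
  ring

lemma covDet_four {m : ℕ} (a b c d : Vec m → ℝ) (u v w z : Vec m) :
    covDet ![a, b, c, d] ![u, v, w, z] =
      a u * covDet ![b, c, d] ![v, w, z] - b u * covDet ![a, c, d] ![v, w, z] +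
      c u * covDet ![a, b, d] ![v, w, z] - d u * covDet ![a, b, c] ![v, w, z] := by
  simp only [covDet_three]
  simp [covDet, Matrix.det_succ_row_zero, Fin.sum_univ_succ, Fin.succAbove]
  ring

lemma covDet_five {m : ℕ} (a b c d e : Vec m → ℝ) (u v w z y : Vec m) :
    covDet ![a, b, c, d, e] ![u, v, w, z, y] =
      a u * covDet ![b, c, d, e] ![v, w, z, y] - b u * covDet ![a, c, d, e] ![v, w, z, y] +
      c u * covDet ![a, b, d, e] ![v, w, z, y] - d u * covDet ![a, b, c, e] ![v, w, z, y] +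
      e u * covDet ![a, b, c, d] ![v, w, z, y] := by
  simp only [covDet_four, covDet_three]
  simp [covDet, Matrix.det_succ_row_zero, Fin.sum_univ_succ, Fin.succAbove]
  ring

set_option maxHeartbeats 1000000 in
lemma eq_zero_of_iprod_msf_omegaP1 {x v : Vec (2 * 4 + 1 + 1)}
    (h : iprod v (msf omegaP1) x = 0) : v = 0 := by
  have H (w : Fin 4 → Vec (2 * 4 + 1 + 1)) : msf omegaP1 x (Matrix.vecCons v w) = 0 :=
    congrFun h w
  have h0 := H ![Pi.single 9 1, Pi.single 0 1 + x 5 • Pi.single 4 1,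
    Pi.single 1 1 + x 6 • Pi.single 4 1, Pi.single 2 1 + x 7 • Pi.single 4 1]
  have h1 := H ![Pi.single 9 1, Pi.single 0 1 + x 5 • Pi.single 4 1,
    Pi.single 1 1 + x 6 • Pi.single 4 1, Pi.single 3 1 + x 8 • Pi.single 4 1]
  have h2 := H ![Pi.single 9 1, Pi.single 0 1 + x 5 • Pi.single 4 1,
    Pi.single 2 1 + x 7 • Pi.single 4 1, Pi.single 3 1 + x 8 • Pi.single 4 1]
  have h3 := H ![Pi.single 9 1, Pi.single 1 1 + x 6 • Pi.single 4 1,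
    Pi.single 2 1 + x 7 • Pi.single 4 1, Pi.single 3 1 + x 8 • Pi.single 4 1]
  have h4 := H ![Pi.single 5 1, Pi.single 6 1,
    Pi.single 0 1 + x 5 • Pi.single 4 1, Pi.single 1 1 + x 6 • Pi.single 4 1]
  have h5 := H ![Pi.single 0 1 + x 5 • Pi.single 4 1, Pi.single 1 1 + x 6 • Pi.single 4 1,
    Pi.single 2 1 + x 7 • Pi.single 4 1, Pi.single 3 1 + x 8 • Pi.single 4 1]
  have h6 := H ![Pi.single 4 1, Pi.single 6 1,
    Pi.single 0 1 + x 5 • Pi.single 4 1, Pi.single 1 1 + x 6 • Pi.single 4 1]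
  have h7 := H ![Pi.single 4 1, Pi.single 5 1,
    Pi.single 0 1 + x 5 • Pi.single 4 1, Pi.single 1 1 + x 6 • Pi.single 4 1]
  have h8 := H ![Pi.single 4 1, Pi.single 8 1,
    Pi.single 2 1 + x 7 • Pi.single 4 1, Pi.single 3 1 + x 8 • Pi.single 4 1]
  have h9 := H ![Pi.single 4 1, Pi.single 7 1,
    Pi.single 2 1 + x 7 • Pi.single 4 1, Pi.single 3 1 + x 8 • Pi.single 4 1]
  simp only [msf_omegaP1_apply_explicit] at h0 h1 h2 h3 h4 h5 h6 h7 h8 h9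
  simp [covDet_five, covDet_four, covDet_three, contactCov_apply]
    at h0 h1 h2 h3 h4 h5 h6 h7 h8 h9
  have h4' : v 4 = 0 := by simpa [h0, h1, h2, h3] using h4
  have h9' : v 9 = 0 := by simpa [h0, h1, h2, h3, h4'] using h5
  funext i
  fin_cases i <;> assumption

/-- the 5-form `m = de ∧ β + c ∧ ω` on ℝ¹⁰ built from the effective 4-form
representing the first heavenly equation of Plebański is multisymplectic: `dm = 0` and at
every point the only tangent vector `v` with `v ⌟ m = 0` is `v = 0`. -/
theorem plebanski_first_heavenly_multisymplectic :
    exd (msf omegaP1) = 0 ∧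
      ∀ (x v : Vec (2 * 4 + 1 + 1)), iprod v (msf omegaP1) x = 0 → v = 0 := by
  exact ⟨exd_msf_omegaP1, fun _ _ h => eq_zero_of_iprod_msf_omegaP1 h⟩

end MA
end
end
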